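/- The two-point function Δ₊ is a well-defined tempered distribution: for every Schwartz function g on ℝ⁴, all integrals in Δ₊(g) := (2π)^{−3} ∫_{ℝ³} (1/(2ω(k))) · ( ∫_{ℝ⁴} g(x₀, x⃗) e^{−i ω(k) x₀ + i⟨k, x⃗⟩} dx₀ dx⃗ ) dk converge absolutely, and the map g ↦ Δ₊(g) is a continuous linear functional on the Schwartz space 𝒮(ℝ⁴, ℂ). -/

import Mathlib

open MeasureTheory

/-- The on-shell energy `ω(k) = √(|k|² + m²)` for `k ∈ ℝ³`. -/
noncomputable def omega (m : ℝ) (k : Fin 3 → ℝ) : ℝ :=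
  Real.sqrt ((∑ i, k i ^ 2) + m ^ 2)

/-- The two-point function `Δ₊` of the free scalar field of mass `m`, as a functional:
`Δ₊(g) = (2π)⁻³ ∫_{ℝ³} (1/(2ω(k))) ∫_{ℝ⁴} g(x₀,x⃗) e^{−iω(k)x₀ + i⟨k,x⃗⟩} dx dk`. -/
noncomputable def twoPoint (m : ℝ) (g : (ℝ × (Fin 3 → ℝ)) → ℂ) : ℂ :=
  ((((2 * Real.pi) ^ 3)⁻¹ : ℝ) : ℂ) *
    ∫ k : Fin 3 → ℝ, (((2 * omega m k)⁻¹ : ℝ) : ℂ) *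
      ∫ x : ℝ × (Fin 3 → ℝ),
        g x * Complex.exp (-Complex.I * (omega m k : ℂ) * (x.1 : ℂ) +
          Complex.I * ∑ i, (k i : ℂ) * (x.2 i : ℂ))

open scoped FourierTransform SchwartzMap

/-- Minkowski space `ℝ × ℝ³` with its Euclidean inner product. -/
abbrev EuclideanSpacetime : Type := WithLp 2 (ℝ × EuclideanSpace ℝ (Fin 3))

namespace EuclideanSpacetime

/-- The identification of `EuclideanSpacetime` with the plain product `ℝ × (Fin 3 → ℝ)`. -/
noncomputable def equivProd : EuclideanSpacetime ≃L[ℝ] ℝ × (Fin 3 → ℝ) :=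
  (WithLp.prodContinuousLinearEquiv 2 ℝ ℝ (EuclideanSpace ℝ (Fin 3))).trans
    ((ContinuousLinearEquiv.refl ℝ ℝ).prodCongr (EuclideanSpace.equiv (Fin 3) ℝ))

theorem equivProd_apply (v : EuclideanSpacetime) :
    equivProd v = (v.fst, WithLp.ofLp v.snd) := rfl

theorem measurePreserving_equivProd : MeasurePreserving equivProd :=
  ((MeasurePreserving.id volume).prod (PiLp.volume_preserving_ofLp (Fin 3))).comp
    (WithLp.volume_preserving_ofLp ℝ (EuclideanSpace ℝ (Fin 3)))

end EuclideanSpacetime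

open EuclideanSpacetime

theorem continuous_omega (m : ℝ) : Continuous (omega m) := by
  unfold omega
  fun_prop

theorem omega_pos {m : ℝ} (hm : 0 < m) (k : Fin 3 → ℝ) : 0 < omega m k :=
  Real.sqrt_pos.2 (by positivity)

/-- The dual variable at which the Fourier transform (with Mathlib's normalization) has the
mass-shell phase `-iω(k)x₀ + i⟨k, x⟩`. -/
noncomputable def massShellPoint (m : ℝ) (k : Fin 3 → ℝ) : EuclideanSpacetime :=
  WithLp.toLp 2 ((2 * Real.pi)⁻¹ * omega m k, WithLp.toLp 2 fun i => -((2 * Real.pi)⁻¹ * k i))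

theorem continuous_massShellPoint (m : ℝ) : Continuous (massShellPoint m) := by
  have := continuous_omega m
  unfold massShellPoint
  fun_prop

theorem norm_le_norm_massShellPoint (m : ℝ) (k : Fin 3 → ℝ) :
    (2 * Real.pi)⁻¹ * ‖k‖ ≤ ‖massShellPoint m k‖ := by
  have hpi : 0 < (2 * Real.pi)⁻¹ := by positivity
  rw [← le_inv_mul_iff₀ hpi, pi_norm_le_iff_of_nonneg (by positivity)]
  intro i
  rw [le_inv_mul_iff₀ hpi]
  calc (2 * Real.pi)⁻¹ * ‖k i‖ = ‖(massShellPoint m k).snd i‖ := by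
        simp [massShellPoint, abs_of_pos Real.pi_pos]
    _ ≤ ‖(massShellPoint m k).snd‖ := PiLp.norm_apply_le _ i
    _ ≤ ‖massShellPoint m k‖ := WithLp.norm_snd_le _ _

/-- The weight `1 / (2ω(k))` with values in `ℝ≥0`. -/
noncomputable def massShellWeight (m : ℝ) (k : Fin 3 → ℝ) : NNReal :=
  ((2 * omega m k)⁻¹).toNNReal

theorem measurable_massShellWeight (m : ℝ) : Measurable (massShellWeight m) := by
  have := (continuous_omega m).measurable
  unfold massShellWeight
  fun_prop

theorem coe_massShellWeight {m : ℝ} (hm : 0 < m) (k : Fin 3 → ℝ) :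
    (massShellWeight m k : ℝ) = (2 * omega m k)⁻¹ :=
  Real.coe_toNNReal _ (by have := omega_pos hm k; positivity)

theorem massShellWeight_le {m : ℝ} (hm : 0 < m) (k : Fin 3 → ℝ) :
    (massShellWeight m k : ℝ) ≤ (2 * m)⁻¹ := by
  rw [coe_massShellWeight hm]
  have : m ≤ omega m k := Real.le_sqrt_of_sq_le (le_add_of_nonneg_left (by positivity))
  gcongr

/-- The Lorentz-invariant measure `dk / (2ω(k))` on the rescaled mass shell. -/
noncomputable def massShellMeasure (m : ℝ) : Measure EuclideanSpacetime :=
  (volume.withDensity fun k => (massShellWeight m k : ENNReal)).map (massShellPoint m)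

theorem integrable_massShellMeasure_iff (m : ℝ) {F : Type*} [NormedAddCommGroup F]
    [NormedSpace ℝ F] {f : EuclideanSpacetime → F} (hf : StronglyMeasurable f) :
    Integrable f (massShellMeasure m) ↔
      Integrable fun k => massShellWeight m k • f (massShellPoint m k) := by
  rw [massShellMeasure, integrable_map_measure hf.aestronglyMeasurable
    (continuous_massShellPoint m).aemeasurable,
    integrable_withDensity_iff_integrable_smul (measurable_massShellWeight m)]
  rfl

theorem integral_massShellMeasure (m : ℝ) {F : Type*} [NormedAddCommGroup F]
    [NormedSpace ℝ F] {f : EuclideanSpacetime → F} (hf : StronglyMeasurable f) :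
    ∫ v, f v ∂massShellMeasure m = ∫ k, massShellWeight m k • f (massShellPoint m k) := by
  rw [massShellMeasure, integral_map (continuous_massShellPoint m).aemeasurable
    hf.aestronglyMeasurable,
    integral_withDensity_eq_integral_smul (measurable_massShellWeight m)]

theorem hasTemperateGrowth_massShellMeasure {m : ℝ} (hm : 0 < m) :
    (massShellMeasure m).HasTemperateGrowth := by
  refine ⟨4, ?_⟩
  have hmeas : StronglyMeasurable fun v : EuclideanSpacetime => (1 + ‖v‖) ^ (-((4 : ℕ) : ℝ)) :=
    Measurable.stronglyMeasurable (by fun_prop)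
  rw [integrable_massShellMeasure_iff m hmeas]
  have hint : Integrable fun k : Fin 3 → ℝ => (1 + ‖k‖) ^ (-(4 : ℝ)) :=
    integrable_one_add_norm (by norm_num)
  refine (hint.const_mul ((2 * m)⁻¹ * (2 * Real.pi) ^ 4)).mono'
    ((measurable_massShellWeight m).smul
      (hmeas.measurable.comp (continuous_massShellPoint m).measurable)).aestronglyMeasurable
    (Filter.Eventually.of_forall fun k => ?_)
  have hle : (2 * Real.pi)⁻¹ * (1 + ‖k‖) ≤ 1 + ‖massShellPoint m k‖ := by
    have h1 : (2 * Real.pi)⁻¹ ≤ 1 := inv_le_one_of_one_le₀ (by linarith [Real.pi_gt_three])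
    linarith [norm_le_norm_massShellPoint m k]
  have hpow : (1 + ‖massShellPoint m k‖) ^ (-((4 : ℕ) : ℝ)) ≤
      (2 * Real.pi) ^ 4 * (1 + ‖k‖) ^ (-(4 : ℝ)) := by
    calc (1 + ‖massShellPoint m k‖) ^ (-((4 : ℕ) : ℝ))
        ≤ ((2 * Real.pi)⁻¹ * (1 + ‖k‖)) ^ (-((4 : ℕ) : ℝ)) :=
          Real.rpow_le_rpow_of_nonpos (by positivity) hle (by norm_num)
      _ = (2 * Real.pi) ^ 4 * (1 + ‖k‖) ^ (-(4 : ℝ)) := by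
          rw [show (-(4 : ℝ)) = -((4 : ℕ) : ℝ) by norm_num, Real.rpow_neg (by positivity),
            Real.rpow_neg (by positivity), Real.rpow_natCast, Real.rpow_natCast, mul_pow,
            mul_inv, inv_pow, inv_inv]
  rw [NNReal.smul_def, smul_eq_mul, Real.norm_of_nonneg (by positivity), mul_assoc]
  exact mul_le_mul (massShellWeight_le hm k) hpow (by positivity) (by positivity)

/-- The mass-shell phase appearing in `twoPoint`. -/
theorem exp_massShellPhase_eq (m : ℝ) (k : Fin 3 → ℝ) (v : EuclideanSpacetime) :
    Complex.exp (-Complex.I * (omega m k : ℂ) * ((equivProd v).1 : ℂ) +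
      Complex.I * ∑ i, (k i : ℂ) * ((equivProd v).2 i : ℂ)) =
    Complex.exp (((-2 * Real.pi * inner ℝ v (massShellPoint m k) : ℝ) : ℂ) * Complex.I) := by
  have hpi : (Real.pi : ℂ) ≠ 0 := by exact_mod_cast Real.pi_ne_zero
  congr 1
  simp only [equivProd_apply, massShellPoint, WithLp.prod_inner_apply, PiLp.inner_apply,
    Fin.sum_univ_three, Real.inner_apply]
  push_cast
  field_simp
  simp only [WithLp.fst, WithLp.snd]
  ring

theorem fourier_massShellPoint (m : ℝ) (k : Fin 3 → ℝ) (g : 𝓢(ℝ × (Fin 3 → ℝ), ℂ)) :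
    𝓕 (g ∘ equivProd) (massShellPoint m k) =
      ∫ x : ℝ × (Fin 3 → ℝ),
        g x * Complex.exp (-Complex.I * (omega m k : ℂ) * (x.1 : ℂ) +
          Complex.I * ∑ i, (k i : ℂ) * (x.2 i : ℂ)) := by
  rw [← measurePreserving_equivProd.integral_comp
    equivProd.toHomeomorph.measurableEmbedding, Real.fourier_eq']
  simp only [exp_massShellPhase_eq, Function.comp_apply, smul_eq_mul,
    mul_comm (Complex.exp _)]

theorem integrable_mul_exp_massShellPhase (m : ℝ) (k : Fin 3 → ℝ)
    (g : 𝓢(ℝ × (Fin 3 → ℝ), ℂ)) :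
    Integrable fun x : ℝ × (Fin 3 → ℝ) =>
      g x * Complex.exp (-Complex.I * (omega m k : ℂ) * (x.1 : ℂ) +
        Complex.I * ∑ i, (k i : ℂ) * (x.2 i : ℂ)) := by
  have : (volume : Measure (ℝ × (Fin 3 → ℝ))).IsAddHaarMeasure :=
    inferInstanceAs ((volume : Measure ℝ).prod volume).IsAddHaarMeasure
  refine (g.integrable (μ := volume)).mul_bdd (c := 1) (by fun_prop)
    (Filter.Eventually.of_forall fun x => ?_)
  simp [Complex.norm_exp]

/-- Fourier transform of Schwartz functions on the product `ℝ × ℝ³`. -/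
noncomputable def spacetimeFourierCLM : 𝓢(ℝ × (Fin 3 → ℝ), ℂ) →L[ℂ] 𝓢(EuclideanSpacetime, ℂ) :=
  FourierTransform.fourierCLM ℂ 𝓢(EuclideanSpacetime, ℂ) ∘L
    SchwartzMap.compCLMOfContinuousLinearEquiv ℂ equivProd

theorem massShellWeight_smul_spacetimeFourierCLM {m : ℝ} (hm : 0 < m) (k : Fin 3 → ℝ)
    (g : 𝓢(ℝ × (Fin 3 → ℝ), ℂ)) :
    massShellWeight m k • spacetimeFourierCLM g (massShellPoint m k) =
      (((2 * omega m k)⁻¹ : ℝ) : ℂ) * ∫ x : ℝ × (Fin 3 → ℝ),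
        g x * Complex.exp (-Complex.I * (omega m k : ℂ) * (x.1 : ℂ) +
          Complex.I * ∑ i, (k i : ℂ) * (x.2 i : ℂ)) := by
  rw [← fourier_massShellPoint, NNReal.smul_def, coe_massShellWeight hm, Complex.real_smul]
  rfl

/-- The two-point function `Δ₊` is a well-defined tempered distribution: for every
Schwartz `g` all integrals converge absolutely, and `g ↦ Δ₊(g)` is a continuous linear
functional on Schwartz space. -/
theorem twoPoint_tempered (m : ℝ) (hm : 0 < m) :
    (∀ g : SchwartzMap (ℝ × (Fin 3 → ℝ)) ℂ, ∀ k : Fin 3 → ℝ,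
      Integrable (fun x : ℝ × (Fin 3 → ℝ) =>
        g x * Complex.exp (-Complex.I * (omega m k : ℂ) * (x.1 : ℂ) +
          Complex.I * ∑ i, (k i : ℂ) * (x.2 i : ℂ)))) ∧
    (∀ g : SchwartzMap (ℝ × (Fin 3 → ℝ)) ℂ,
      Integrable (fun k : Fin 3 → ℝ => (((2 * omega m k)⁻¹ : ℝ) : ℂ) *
        ∫ x : ℝ × (Fin 3 → ℝ),
          g x * Complex.exp (-Complex.I * (omega m k : ℂ) * (x.1 : ℂ) +
            Complex.I * ∑ i, (k i : ℂ) * (x.2 i : ℂ)))) ∧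
    ∃ u : SchwartzMap (ℝ × (Fin 3 → ℝ)) ℂ →L[ℂ] ℂ,
      ∀ g : SchwartzMap (ℝ × (Fin 3 → ℝ)) ℂ, u g = twoPoint m g := by
  have := hasTemperateGrowth_massShellMeasure hm
  refine ⟨fun g k => integrable_mul_exp_massShellPhase m k g, fun g => ?_,
    ((((2 * Real.pi) ^ 3)⁻¹ : ℝ) : ℂ) •
      (SchwartzMap.integralCLM ℂ (massShellMeasure m) ∘L spacetimeFourierCLM), fun g => ?_⟩
  · have h := (integrable_massShellMeasure_iff m
      (spacetimeFourierCLM g).continuous.stronglyMeasurable).1 (spacetimeFourierCLM g).integrable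
    simpa only [massShellWeight_smul_spacetimeFourierCLM hm] using h
  · rw [smul_apply, ContinuousLinearMap.comp_apply,
      SchwartzMap.integralCLM_apply, integral_massShellMeasure m
      (spacetimeFourierCLM g).continuous.stronglyMeasurable]
    simp only [massShellWeight_smul_spacetimeFourierCLM hm, smul_eq_mul, twoPoint]
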